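/- If κ is an almost ineffable cardinal, then the subtle ideal NSub_κ is properly contained in the almost ineffable ideal I([κ]^{<κ}), i.e., NSub_κ ⊊ I([κ]^{<κ}). -/

import Mathlib

namespace LCI


/-- `κ` is (the initial ordinal of) a regular uncountable cardinal. -/
def RegUncountable (kappa : Ordinal.{0}) : Prop :=
  Ordinal.omega0 < kappa ∧ kappa.cof.ord = kappa

/-- `C` is a club (closed unbounded) subset of the ordinal `κ`. -/
def IsClubIn (C : Set Ordinal.{0}) (kappa : Ordinal.{0}) : Prop :=
  C ⊆ Set.Iio kappa ∧
  (∀ alpha < kappa, ∃ beta ∈ C, alpha < beta) ∧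
  ∀ beta < kappa, beta ≠ 0 →
    (∀ gamma < beta, ∃ delta ∈ C, gamma < delta ∧ delta < beta) → beta ∈ C

/-- `S` is a stationary subset of the ordinal `κ`. -/
def IsStationaryIn (S : Set Ordinal.{0}) (kappa : Ordinal.{0}) : Prop :=
  S ⊆ Set.Iio kappa ∧ ∀ C, IsClubIn C kappa → (S ∩ C).Nonempty

/-- `H` is homogeneous for the list `L` (where `L α ⊆ α` on the relevant domain):
whenever `α < β` are both in `H`, `L α = L β ∩ α`. -/
def Homog (L : Ordinal.{0} → Set Ordinal.{0}) (H : Set Ordinal.{0}) : Prop :=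
  ∀ alpha ∈ H, ∀ beta ∈ H, alpha < beta → L alpha = L beta ∩ Set.Iio alpha

/-- `S ⊆ κ` is a subtle subset of `κ`: for every `S`-list `L` (i.e. `L α ⊆ α` for
`α ∈ S`) and every club `C ⊆ κ` there are `α < β` in `S ∩ C` with `L α = L β ∩ α`. -/
def IsSubtleIn (S : Set Ordinal.{0}) (kappa : Ordinal.{0}) : Prop :=
  S ⊆ Set.Iio kappa ∧
  ∀ L : Ordinal.{0} → Set Ordinal.{0}, (∀ alpha ∈ S, L alpha ⊆ Set.Iio alpha) →
    ∀ C, IsClubIn C kappa →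
      ∃ alpha ∈ S ∩ C, ∃ beta ∈ S ∩ C, alpha < beta ∧ L alpha = L beta ∩ Set.Iio alpha

/-- The subtle ideal on `κ`: the collection of non-subtle subsets of `κ`. -/
def NSub (kappa : Ordinal.{0}) : Set (Set Ordinal.{0}) :=
  {X | X ⊆ Set.Iio kappa ∧ ¬ IsSubtleIn X kappa}

/-- `S ∈ 𝓘(I)⁺` for the ideal with positive sets `P` : every `S`-list has a
homogeneous subset `H ⊆ S` satisfying `P`. -/
def IneffPos (kappa : Ordinal.{0}) (P : Set Ordinal.{0} → Prop) (S : Set Ordinal.{0}) : Prop :=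
  S ⊆ Set.Iio kappa ∧
  ∀ L : Ordinal.{0} → Set Ordinal.{0}, (∀ alpha ∈ S, L alpha ⊆ Set.Iio alpha) →
    ∃ H, H ⊆ S ∧ P H ∧ Homog L H

/-- The almost ineffable ideal `𝓘([κ]^{<κ})` on `κ`. -/
def AlmostIneffIdeal (kappa : Ordinal.{0}) : Set (Set Ordinal.{0}) :=
  {X | X ⊆ Set.Iio kappa ∧
    ¬ IneffPos kappa (fun H => Cardinal.mk ↥H = Cardinal.lift.{1} kappa.card) X}

/-- `alpha` is a nonzero limit of elements of `C`. -/
def IsLimitPt (C : Set Ordinal.{0}) (alpha : Ordinal.{0}) : Prop :=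
  alpha ≠ 0 ∧ ∀ gamma < alpha, ∃ delta ∈ C, gamma < delta ∧ delta < alpha

/-- `alpha` is closed under `xi ↦ xi * xi + xi`, hence under the coding of pairs `eta ≤ xi`
by `xi * xi + eta`. -/
def ClosedUnderPairing (alpha : Ordinal.{0}) : Prop :=
  ∀ xi < alpha, xi * xi + xi < alpha

/-- The ordinals below `kappa` that are closed under pairing and not subtle. -/
def nonSubtleBelow (kappa : Ordinal.{0}) : Set Ordinal.{0} :=
  {alpha | alpha < kappa ∧ ClosedUnderPairing alpha ∧ ¬ IsSubtleIn (Set.Iio alpha) alpha}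

theorem IsLimitPt.one_add_lt_iff {C : Set Ordinal.{0}} {alpha xi : Ordinal.{0}}
    (hl : IsLimitPt C alpha) : 1 + xi < alpha ↔ xi < alpha := by
  refine ⟨le_add_self.trans_lt, fun h => ?_⟩
  have hle : 1 + xi ≤ Order.succ xi := by
    rcases lt_or_ge xi Ordinal.omega0 with hω | hω
    · obtain ⟨n, rfl⟩ := Ordinal.lt_omega0.1 hω
      exact (Nat.cast_add_one_comm n).ge
    · exact (Ordinal.one_add_of_omega0_le hω).le.trans (Order.le_succ xi)
  obtain ⟨δ, -, h1, h2⟩ := hl.2 xi h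
  exact hle.trans_lt ((Order.succ_le_of_lt h1).trans_lt h2)

theorem IsClubIn.inter_Iio {C : Set Ordinal.{0}} {kappa alpha : Ordinal.{0}}
    (hC : IsClubIn C kappa) (hα : alpha ≤ kappa) (hlim : IsLimitPt C alpha) :
    IsClubIn (C ∩ Set.Iio alpha) alpha := by
  refine ⟨fun x hx => hx.2, fun γ hγ => ?_, fun β hβ hβ0 hl => ⟨?_, hβ⟩⟩
  · obtain ⟨δ, hδ, h1, h2⟩ := hlim.2 γ hγ
    exact ⟨δ, ⟨hδ, h2⟩, h1⟩
  · refine hC.2.2 β (hβ.trans_le hα) hβ0 fun γ hγ => ?_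
    obtain ⟨δ, hδ, h⟩ := hl γ hγ
    exact ⟨δ, hδ.1, h⟩

theorem RegUncountable.card_ord {kappa : Ordinal.{0}} (hreg : RegUncountable kappa) :
    kappa.card.ord = kappa := by
  conv_lhs => rw [← hreg.2]
  rw [Cardinal.card_ord, hreg.2]

theorem RegUncountable.closedUnderPairing {kappa : Ordinal.{0}} (hreg : RegUncountable kappa) :
    ClosedUnderPairing kappa := by
  have hω : Cardinal.aleph0 ≤ kappa.card := by
    rw [← Cardinal.ord_le_ord, hreg.card_ord, Cardinal.ord_aleph0]
    exact hreg.1.le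
  have hadd := Ordinal.isPrincipal_add_ord hω
  have hmul := Ordinal.isPrincipal_mul_ord hω
  rw [hreg.card_ord] at hadd hmul
  exact fun ξ hξ => hadd (hmul hξ hξ) hξ

theorem RegUncountable.exists_gt_of_mk_eq {kappa : Ordinal.{0}} (hreg : RegUncountable kappa)
    {H : Set Ordinal.{0}} (hH : Cardinal.mk H = Cardinal.lift.{1} kappa.card) {gamma : Ordinal.{0}}
    (hγ : gamma < kappa) : ∃ alpha ∈ H, gamma < alpha := by
  by_contra! hcon
  have hω : Order.IsSuccLimit kappa := by
    rw [← hreg.card_ord]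
    refine Cardinal.isSuccLimit_ord ?_
    rw [← Cardinal.ord_le_ord, hreg.card_ord, Cardinal.ord_aleph0]
    exact hreg.1.le
  have hle : Cardinal.mk H ≤ Cardinal.mk (Set.Iio (Order.succ gamma)) :=
    Cardinal.mk_le_mk_of_subset fun x hx => Order.lt_succ_of_le (hcon x hx)
  rw [hH, Cardinal.mk_Iio_ordinal, Cardinal.lift_le] at hle
  have := Cardinal.ord_le_ord.2 hle
  rw [hreg.card_ord] at this
  exact absurd (this.trans (Cardinal.ord_card_le _)) (not_le.2 (hω.succ_lt hγ))

/-- An almost ineffable set is subtle. -/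
theorem RegUncountable.isSubtleIn_of_ineffPos {kappa : Ordinal.{0}} (hreg : RegUncountable kappa)
    {X : Set Ordinal.{0}}
    (h : IneffPos kappa (fun H => Cardinal.mk ↥H = Cardinal.lift.{1} kappa.card) X) :
    IsSubtleIn X kappa := by
  refine ⟨h.1, fun L hL C hC => ?_⟩
  classical
  obtain ⟨H, hHX, hHc, hH⟩ := h.2 (fun α => if IsLimitPt C α then
      {ζ | ζ = 0 ∨ ∃ ξ ∈ L α, ζ = 1 + ξ} else {ξ | ξ < α ∧ ∀ δ ∈ C, δ < α → δ ≤ ξ}) (by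
    intro α hα ζ hζ
    split_ifs at hζ with hl
    · rcases hζ with rfl | ⟨ξ, hξ, rfl⟩
      · exact pos_iff_ne_zero.2 hl.1
      · obtain ⟨δ, hδ, h1, h2⟩ := hl.2 ξ (hL α hα hξ)
        exact hl.one_add_lt_iff.2 (h1.trans h2)
    · exact hζ.1)
  have hunb := fun {γ} => hreg.exists_gt_of_mk_eq hHc (gamma := γ)
  obtain ⟨c, hcC, hc⟩ := hC.2.1 0 (Ordinal.omega0_pos.trans hreg.1)
  obtain ⟨α, hα, hcα⟩ := hunb (hC.1 hcC)
  obtain ⟨δ, hδC, hαδ⟩ := hC.2.1 α (h.1 (hHX hα))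
  obtain ⟨β, hβ, hδβ⟩ := hunb (hC.1 hδC)
  have hαβ := hαδ.trans hδβ
  have key := hH α hα β hβ hαβ
  have hα0 : 0 < α := hc.trans hcα
  by_cases hlα : IsLimitPt C α <;> by_cases hlβ : IsLimitPt C β <;>
    simp only [hlα, hlβ, if_true, if_false, Set.ext_iff, Set.mem_inter_iff, Set.mem_ofPred_eq,
      Set.mem_Iio] at key
  · refine ⟨α, ⟨hHX hα, hC.2.2 α (h.1 (hHX hα)) hlα.1 hlα.2⟩, β,
      ⟨hHX hβ, hC.2.2 β (h.1 (hHX hβ)) hlβ.1 hlβ.2⟩, hαβ, ?_⟩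
    ext ξ
    have hξ := key (1 + ξ)
    have h1 : (1 + ξ : Ordinal.{0}) ≠ 0 := ((zero_lt_one' Ordinal.{0}).trans_le le_self_add).ne'
    simp only [h1, false_or, add_right_inj, exists_eq_right', hlα.one_add_lt_iff] at hξ
    exact hξ
  · exact absurd (((key 0).1 (Or.inl rfl)).1.2 c hcC (hcα.trans hαβ)) (not_le.2 hc)
  · exact absurd (((key 0).2 ⟨Or.inl rfl, hα0⟩).2 c hcC hcα) (not_le.2 hc)
  · refine absurd ⟨hα0.ne', fun γ hγ => ?_⟩ hlα
    by_contra! hcon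
    have := ((key γ).1 ⟨hγ, fun δ hδ hδα => not_lt.1 fun hlt => (hcon δ hδ hlt).not_gt hδα⟩).1
    exact (this.2 δ hδC hδβ).not_gt (hγ.trans hαδ)

/-- Below a subtle ordinal closed under pairing, the limit points of a club that are closed under
pairing form a club. -/
theorem isClubIn_limitPt_closedUnderPairing {kappa : Ordinal.{0}}
    (hκ : IsSubtleIn (Set.Iio kappa) kappa) (hD : ClosedUnderPairing kappa)
    {C : Set Ordinal.{0}} (hC : IsClubIn C kappa) :
    IsClubIn {alpha | alpha < kappa ∧ ClosedUnderPairing alpha ∧ IsLimitPt C alpha} kappa := by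
  refine ⟨fun x hx => hx.1, fun γ hγ => ?_, fun β hβ hβ0 hl => ⟨hβ, fun ξ hξ => ?_, hβ0,
    fun ξ hξ => ?_⟩⟩
  · by_contra! hcon
    have hstep : ∀ ξ : Set.Iio kappa, ∃ ζ : Set.Iio kappa, ζ.1 ∈ C ∧ ξ.1 * ξ.1 + ξ.1 < ζ.1 := by
      intro ξ
      obtain ⟨ζ, hζ, h⟩ := hC.2.1 _ (hD ξ ξ.2)
      exact ⟨⟨ζ, hC.1 hζ⟩, hζ, h⟩
    choose f hfC hf using hstep
    let e : ℕ → Set.Iio kappa := fun n => f^[n + 1] ⟨γ, hγ⟩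
    have hsucc : ∀ n, e (n + 1) = f (e n) := fun n => Function.iterate_succ_apply' _ _ _
    have he : ∀ n, (e n).1 * (e n).1 + (e n).1 < (e (n + 1)).1 := fun n => by
      rw [hsucc]; exact hf _
    have hlt : ∀ n, (e n).1 < (e (n + 1)).1 := fun n => le_add_self.trans_lt (he n)
    have hmono : StrictMono fun n => (e n).1 := strictMono_nat_of_lt_succ hlt
    have hγe : ∀ n, γ < (e n).1 := by
      intro n
      refine lt_of_lt_of_le ?_ (hmono.monotone n.zero_le)
      exact le_add_self.trans_lt (hf _)
    have heC : ∀ n, (e n).1 ∈ C := by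
      intro n
      cases n with
      | zero => exact hfC _
      | succ n => rw [hsucc]; exact hfC _
    have hnolim : ∀ α < kappa, ¬ IsLimitPt (Set.range fun n => (e n).1) α := by
      intro α hα hl
      have hnext : ∀ n, (e n).1 < α → (e (n + 1)).1 < α := by
        intro n hn
        obtain ⟨_, ⟨m, rfl⟩, h1, h2⟩ := hl.2 _ hn
        exact (hmono.monotone (Nat.succ_le_of_lt (hmono.lt_iff_lt.1 h1))).trans_lt h2
      refine (hcon α ⟨hα, fun ξ hξ => ?_, hl.1, fun ξ hξ => ?_⟩).not_gt ?_
      · obtain ⟨_, ⟨m, rfl⟩, h1, h2⟩ := hl.2 _ hξ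
        exact ((add_le_add (mul_le_mul' h1.le h1.le) h1.le).trans_lt (he m)).trans (hnext m h2)
      · obtain ⟨_, ⟨m, rfl⟩, h1, h2⟩ := hl.2 _ hξ
        exact ⟨_, heC m, h1, h2⟩
      · obtain ⟨_, ⟨m, rfl⟩, -, h2⟩ := hl.2 0 (pos_iff_ne_zero.2 hl.1)
        exact (hγe m).trans h2
    have hclub : IsClubIn (Set.range fun n => (e n).1) kappa := by
      refine ⟨?_, fun α hα => ?_, fun β hβ h0 hl => absurd ⟨h0, hl⟩ (hnolim β hβ)⟩
      · rintro _ ⟨n, rfl⟩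
        exact (e n).2
      · by_contra! hb
        have hbound : α ∈ {x | ∀ n, (e n).1 ≤ x} := fun n => hb _ ⟨n, rfl⟩
        have hmem := csInf_mem ⟨α, hbound⟩
        have hltInf : ∀ n, (e n).1 < sInf {x | ∀ n, (e n).1 ≤ x} :=
          fun n => (hlt n).trans_le (hmem (n + 1))
        refine hnolim _ ((csInf_le' hbound).trans_lt hα)
          ⟨(bot_le.trans_lt (hltInf 0)).ne', fun ξ hξ => ?_⟩
        have := notMem_of_lt_csInf' hξ
        simp only [Set.mem_ofPred_eq, not_forall, not_le] at this
        obtain ⟨n, hn⟩ := this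
        exact ⟨_, ⟨n, rfl⟩, hn, hltInf n⟩
    obtain ⟨α, hα, β, hβ, hαβ, heq⟩ := hκ.2
      (fun α => {ξ | ξ < α ∧ ∀ n, (e n).1 < α → (e n).1 ≤ ξ}) (fun α _ ξ hξ => hξ.1) _ hclub
    refine hnolim α hα.1 ⟨(?_ : γ < α).ne_bot, fun ξ hξ => ?_⟩
    · obtain ⟨_, n, rfl⟩ := hα
      exact hγe n
    · by_contra! hcon'
      have hmem : ξ ∈ {ξ | ξ < α ∧ ∀ n, (e n).1 < α → (e n).1 ≤ ξ} :=
        ⟨hξ, fun n hn => not_lt.1 fun hlt => (hcon' _ ⟨n, rfl⟩ hlt).not_gt hn⟩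
      rw [heq] at hmem
      obtain ⟨_, n, rfl⟩ := hα
      exact (hmem.1.2 n hαβ).not_gt hξ
  · obtain ⟨δ, hδ, h1, h2⟩ := hl ξ hξ
    exact (hδ.2.1 ξ h1).trans h2
  · obtain ⟨δ, hδ, h1, h2⟩ := hl ξ hξ
    obtain ⟨ε, hε, h3, h4⟩ := hδ.2.2.2 ξ h1
    exact ⟨ε, hε, h3, h4.trans h2⟩

theorem isSubtleIn_nonSubtleBelow (kappa : Ordinal.{0})
    (hκ : IsSubtleIn (Set.Iio kappa) kappa) (hD : ClosedUnderPairing kappa) :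
    IsSubtleIn (nonSubtleBelow kappa) kappa := by
  induction kappa using WellFoundedLT.induction with
  | ind kappa ih =>
  refine ⟨fun x hx => hx.1, fun L hL C hC => ?_⟩
  by_cases hex : ∃ α < kappa, ClosedUnderPairing α ∧ IsLimitPt C α ∧ IsSubtleIn (Set.Iio α) α
  · obtain ⟨α, hα, hαD, hαl, hαs⟩ := hex
    have hsub : nonSubtleBelow α ⊆ nonSubtleBelow kappa := fun x hx => ⟨hx.1.trans hα, hx.2⟩
    obtain ⟨ξ, hξ, η, hη, hlt, heq⟩ := (ih α hα hαs hαD).2 L (fun ξ hξ => hL ξ (hsub hξ)) _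
      (hC.inter_Iio hα.le hαl)
    exact ⟨ξ, ⟨hsub hξ.1, hξ.2.1⟩, η, ⟨hsub hη.1, hη.2.1⟩, hlt, heq⟩
  · push Not at hex
    have hmem : ∀ α, α < kappa ∧ ClosedUnderPairing α ∧ IsLimitPt C α →
        α ∈ nonSubtleBelow kappa ∩ C := fun α hα =>
      ⟨⟨hα.1, hα.2.1, hex α hα.1 hα.2.1 hα.2.2⟩, hC.2.2 α hα.1 hα.2.2.1 hα.2.2.2⟩
    obtain ⟨α, hα, β, hβ, hlt, heq⟩ := hκ.2 (fun α => L α ∩ Set.Iio α)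
      (fun α _ => Set.inter_subset_right) _ (isClubIn_limitPt_closedUnderPairing hκ hD hC)
    refine ⟨α, hmem α hα.2, β, hmem β hβ.2, hlt, ?_⟩
    rwa [Set.inter_eq_left.2 (hL α (hmem α hα.2).1),
      Set.inter_eq_left.2 (hL β (hmem β hβ.2).1)] at heq

theorem mul_self_add_lt {a b c d : Ordinal.{0}} (hb : b ≤ a) (hac : a < c) :
    a * a + b < c * c + d := by
  have h1 : a * a + b < Order.succ a * Order.succ a := by
    rw [Ordinal.mul_succ]
    exact (add_le_add (mul_le_mul' (Order.le_succ a) le_rfl) hb).trans_lt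
      ((add_lt_add_iff_left _).2 (Order.lt_succ a))
  have h2 := Order.succ_le_of_lt hac
  exact h1.trans_le ((mul_le_mul' h2 h2).trans le_self_add)

theorem mul_self_add_inj {a b c d : Ordinal.{0}} (hb : b ≤ a) (hd : d ≤ c)
    (h : a * a + b = c * c + d) : a = c ∧ b = d := by
  have hac : a = c := le_antisymm
    (not_lt.1 fun hlt => (mul_self_add_lt hd hlt).ne' h)
    (not_lt.1 fun hlt => (mul_self_add_lt hb hlt).ne h)
  subst hac
  exact ⟨rfl, add_left_cancel h⟩

theorem RegUncountable.not_ineffPos_nonSubtleBelow {kappa : Ordinal.{0}}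
    (hreg : RegUncountable kappa) (hκ : IsSubtleIn (Set.Iio kappa) kappa) :
    ¬ IneffPos kappa (fun H => Cardinal.mk ↥H = Cardinal.lift.{1} kappa.card)
      (nonSubtleBelow kappa) := by
  intro h
  have hwit : ∀ α, ∃ L : Ordinal.{0} → Set Ordinal.{0}, ∃ C : Set Ordinal.{0},
      α ∈ nonSubtleBelow kappa → (∀ ξ < α, L ξ ⊆ Set.Iio ξ) ∧ IsClubIn C α ∧
        ∀ ξ ∈ C, ∀ η ∈ C, ξ < η → L ξ ≠ L η ∩ Set.Iio ξ := by
    intro α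
    by_cases hα : α ∈ nonSubtleBelow kappa
    · have hns := hα.2.2
      unfold IsSubtleIn at hns
      push Not at hns
      obtain ⟨L, hL, C, hC, hp⟩ := hns subset_rfl
      exact ⟨L, C, fun _ => ⟨hL, hC, fun ξ hξ η hη hlt =>
        hp ξ ⟨hC.1 hξ, hξ⟩ η ⟨hC.1 hη, hη⟩ hlt⟩⟩
    · exact ⟨fun _ => ∅, ∅, fun h => absurd h hα⟩
  choose L C hwit using hwit
  obtain ⟨H, hHX, hHc, hH⟩ := h.2 (fun α => {ζ | ∃ ξ η, ξ < α ∧ η ≤ ξ ∧ ζ = ξ * ξ + η ∧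
      (η < ξ ∧ η ∈ L α ξ ∨ η = ξ ∧ ξ ∈ C α)}) (by
    rintro α hα _ ⟨ξ, η, hξ, hη, rfl, -⟩
    exact ((add_le_add_iff_left _).2 hη).trans_lt (hα.2.1 ξ hξ))
  have hcode : ∀ α ∈ H, ∀ β ∈ H, α < β → ∀ ξ < α, ∀ η ≤ ξ,
      ((η < ξ ∧ η ∈ L α ξ ∨ η = ξ ∧ ξ ∈ C α) ↔ (η < ξ ∧ η ∈ L β ξ ∨ η = ξ ∧ ξ ∈ C β)) := by
    intro α hα β hβ hαβ ξ hξ η hη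
    have key := Set.ext_iff.1 (hH α hα β hβ hαβ) (ξ * ξ + η)
    have hlt : ξ * ξ + η < α :=
      ((add_le_add_iff_left _).2 hη).trans_lt ((hHX hα).2.1 ξ hξ)
    simp only [Set.mem_inter_iff, Set.mem_ofPred_eq, Set.mem_Iio, hlt, and_true] at key
    constructor
    · intro hx
      obtain ⟨ξ', η', -, hη', heq, hx'⟩ := key.1 ⟨ξ, η, hξ, hη, rfl, hx⟩
      obtain ⟨rfl, rfl⟩ := mul_self_add_inj hη hη' heq
      exact hx'
    · intro hx
      obtain ⟨ξ', η', -, hη', heq, hx'⟩ := key.2 ⟨ξ, η, hξ.trans hαβ, hη, rfl, hx⟩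
      obtain ⟨rfl, rfl⟩ := mul_self_add_inj hη hη' heq
      exact hx'
  have hC_lt : ∀ α ∈ H, ∀ β ∈ H, α < β → ∀ ξ < α, (ξ ∈ C α ↔ ξ ∈ C β) := by
    intro α hα β hβ hαβ ξ hξ
    simpa using hcode α hα β hβ hαβ ξ hξ ξ le_rfl
  have hL_lt : ∀ α ∈ H, ∀ β ∈ H, α < β → ∀ ξ < α, L α ξ = L β ξ := by
    intro α hα β hβ hαβ ξ hξ
    have hα' := (hwit α (hHX hα)).1 ξ hξ
    have hβ' := (hwit β (hHX hβ)).1 ξ (hξ.trans hαβ)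
    ext η
    by_cases hη : η < ξ
    · simpa [hη, hη.ne] using hcode α hα β hβ hαβ ξ hξ η hη.le
    · exact ⟨fun hx => absurd (hα' hx) hη, fun hx => absurd (hβ' hx) hη⟩
  have hC_eq : ∀ α ∈ H, ∀ β ∈ H, ∀ ξ < α, ξ < β → (ξ ∈ C α ↔ ξ ∈ C β) := by
    intro α hα β hβ ξ h1 h2
    rcases lt_trichotomy α β with hlt | rfl | hlt
    · exact hC_lt α hα β hβ hlt ξ h1
    · rfl
    · exact (hC_lt β hβ α hα hlt ξ h2).symm
  have hL_eq : ∀ α ∈ H, ∀ β ∈ H, ∀ ξ < α, ξ < β → L α ξ = L β ξ := by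
    intro α hα β hβ ξ h1 h2
    rcases lt_trichotomy α β with hlt | rfl | hlt
    · exact hL_lt α hα β hβ hlt ξ h1
    · rfl
    · exact (hL_lt β hβ α hα hlt ξ h2).symm
  have hunb : ∀ γ < kappa, ∃ α ∈ H, γ < α :=
    fun γ hγ => hreg.exists_gt_of_mk_eq hHc hγ
  have hnext : ∀ ξ, ∃ α, ξ < kappa → α ∈ H ∧ ξ < α := by
    intro ξ
    by_cases hξ : ξ < kappa
    · obtain ⟨α, hα⟩ := hunb ξ hξ
      exact ⟨α, fun _ => hα⟩
    · exact ⟨0, fun h => absurd h hξ⟩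
  choose N hN using hnext
  have hclub : IsClubIn {ξ | ξ < kappa ∧ ξ ∈ C (N ξ)} kappa := by
    refine ⟨fun ξ hξ => hξ.1, fun γ hγ => ?_, fun β hβ hβ0 hl => ⟨hβ, ?_⟩⟩
    · obtain ⟨hα, hγα⟩ := hN γ hγ
      have hclubα := (hwit _ (hHX hα)).2.1
      obtain ⟨ξ, hξ, hlt⟩ := hclubα.2.1 γ hγα
      have hξα : ξ < N γ := hclubα.1 hξ
      have hξκ : ξ < kappa := hξα.trans (hHX hα).1
      exact ⟨ξ, ⟨hξκ, (hC_eq _ hα _ (hN ξ hξκ).1 ξ hξα (hN ξ hξκ).2).1 hξ⟩, hlt⟩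
    · obtain ⟨hα, hβα⟩ := hN β hβ
      refine (hwit _ (hHX hα)).2.1.2.2 β hβα hβ0 fun γ hγ => ?_
      obtain ⟨δ, hδ, h1, h2⟩ := hl γ hγ
      exact ⟨δ, (hC_eq _ (hN δ hδ.1).1 _ hα δ (hN δ hδ.1).2 (h2.trans hβα)).1 hδ.2, h1, h2⟩
  obtain ⟨ξ, hξ, η, hη, hlt, heq⟩ := hκ.2 (fun ξ => L (N ξ) ξ)
    (fun ξ hξ => (hwit _ (hHX (hN ξ hξ).1)).1 ξ (hN ξ hξ).2) _ hclub
  obtain ⟨hα, hηα⟩ := hN η hη.1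
  obtain ⟨hβ, hξβ⟩ := hN ξ hξ.1
  have hξα := hlt.trans hηα
  refine (hwit _ (hHX hα)).2.2 ξ ((hC_eq _ hβ _ hα ξ hξβ hξα).1 hξ.2.2) η hη.2.2 hlt ?_
  rw [← hL_eq _ hβ _ hα ξ hξβ hξα]
  exact heq

/-- If `κ` is an almost ineffable cardinal then the subtle ideal on `κ`
is properly contained in the almost ineffable ideal on `κ`. -/
theorem nsub_ssubset_almostIneffIdeal (kappa : Ordinal.{0}) (hreg : RegUncountable kappa)
    (h : IneffPos kappa (fun H => Cardinal.mk ↥H = Cardinal.lift.{1} kappa.card) (Set.Iio kappa)) :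
    NSub kappa ⊂ AlmostIneffIdeal kappa := by
  have hκ := hreg.isSubtleIn_of_ineffPos h
  refine ⟨fun X hX => ⟨hX.1, fun hpos => hX.2 (hreg.isSubtleIn_of_ineffPos hpos)⟩, fun hsub => ?_⟩
  have hX : nonSubtleBelow kappa ∈ AlmostIneffIdeal kappa :=
    ⟨fun ξ hξ => hξ.1, hreg.not_ineffPos_nonSubtleBelow hκ⟩
  exact (hsub hX).2 (isSubtleIn_nonSubtleBelow kappa hκ hreg.closedUnderPairing)

end LCI
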